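/- Let f : V_V → W be an ℓ-times Fréchet differentiable map, for some ℓ ≥ 1, on an open subset V_V of a normed vector space V with values in a normed vector space W. Then for all u, v ∈ V_V, ‖D^ℓ f(u) − D^ℓ f(v)‖^{L^ℓ(V^ℓ;W)} ≤ sup{ ‖T^ℓ f(u, x_1,…,x_{N_ℓ}) − T^ℓ f(v, x_1,…,x_{N_ℓ})‖^{T^ℓ_• W} : (x_1,…,x_{N_ℓ}) ∈ V^{N_ℓ} with max_i ‖x_i‖^V ≤ 1 }. -/

import Mathlib

noncomputable section

universe u v

/-- The iterated tangent space `T^ℓ V = V^{2^ℓ}`, defined recursively by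
`T^0 V = V` and `T^{ℓ+1} V = T^ℓ V × T^ℓ V`. -/
def Tang (V : Type u) : ℕ → Type u
  | 0 => V
  | n + 1 => Tang V n × Tang V n

noncomputable instance Tang.instNormedAddCommGroup (V : Type u) [NormedAddCommGroup V] :
    ∀ n, NormedAddCommGroup (Tang V n)
  | 0 => inferInstanceAs (NormedAddCommGroup V)
  | n + 1 =>
    letI := Tang.instNormedAddCommGroup V n
    inferInstanceAs (NormedAddCommGroup (Tang V n × Tang V n))

noncomputable instance Tang.instNormedSpace (V : Type u) [NormedAddCommGroup V]
    [NormedSpace ℝ V] : ∀ n, NormedSpace ℝ (Tang V n)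
  | 0 => inferInstanceAs (NormedSpace ℝ V)
  | n + 1 =>
    letI := Tang.instNormedSpace V n
    inferInstanceAs (NormedSpace ℝ (Tang V n × Tang V n))

/-- The base point `v₀` of a higher tangent vector. -/
def Tang.base {V : Type u} : ∀ n, Tang V n → V
  | 0, v => v
  | n + 1, p => Tang.base n p.1

/-- The fiber norm `‖(v₀, v₁, …, v_N)‖^{T^ℓ_• V} = max {‖v₁‖, …, ‖v_N‖}`: the maximum of
the norms of all entries except the base point. -/
noncomputable def Tang.fiberNorm {V : Type u} [NormedAddCommGroup V] :
    ∀ n, Tang V n → ℝ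
  | 0, _ => 0
  | n + 1, p => max (Tang.fiberNorm n p.1) ‖p.2‖

/-- The iterated tangent map `T^ℓ f`, defined recursively by `T^0 f = f` and
`T^{ℓ+1} f (p, q) = (T^ℓ f p, D(T^ℓ f)(p) q)`. -/
noncomputable def TMap {V : Type u} {W : Type v} [NormedAddCommGroup V] [NormedSpace ℝ V]
    [NormedAddCommGroup W] [NormedSpace ℝ W] (f : V → W) :
    ∀ n, Tang V n → Tang W n
  | 0 => f
  | n + 1 => fun p => (TMap f n p.1, fderiv ℝ (TMap f n) p.1 p.2)

/-- Replace the base point of a higher tangent vector, keeping all other entries. -/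
def Tang.withBase {V : Type u} : ∀ n, V → Tang V n → Tang V n
  | 0, v, _ => v
  | n + 1, v, p => (Tang.withBase n v p.1, p.2)

section Helpers

variable {V : Type u} {W : Type v} [NormedAddCommGroup V] [NormedSpace ℝ V]
  [NormedAddCommGroup W] [NormedSpace ℝ W]

/-- first projection -/
def Tang.fstL (V : Type u) [NormedAddCommGroup V] [NormedSpace ℝ V] (n : ℕ) :
    Tang V (n + 1) →L[ℝ] Tang V n :=
  (ContinuousLinearMap.fst ℝ (Tang V n) (Tang V n) : (Tang V n × Tang V n) →L[ℝ] Tang V n)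

/-- second projection -/
def Tang.sndL (V : Type u) [NormedAddCommGroup V] [NormedSpace ℝ V] (n : ℕ) :
    Tang V (n + 1) →L[ℝ] Tang V n :=
  (ContinuousLinearMap.snd ℝ (Tang V n) (Tang V n) : (Tang V n × Tang V n) →L[ℝ] Tang V n)

/-- base point as a continuous linear map -/
def Tang.baseL (V : Type u) [NormedAddCommGroup V] [NormedSpace ℝ V] :
    ∀ n, Tang V n →L[ℝ] V
  | 0 => ContinuousLinearMap.id ℝ V
  | n + 1 => (Tang.baseL V n).comp (Tang.fstL V n)

/-- last component -/
def Tang.lastL (V : Type u) [NormedAddCommGroup V] [NormedSpace ℝ V] :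
    ∀ n, Tang V n →L[ℝ] V
  | 0 => ContinuousLinearMap.id ℝ V
  | n + 1 => (Tang.lastL V n).comp (Tang.sndL V n)

/-- vector with given base point and zeros elsewhere -/
def Tang.incL (V : Type u) [NormedAddCommGroup V] [NormedSpace ℝ V] :
    ∀ n, V →L[ℝ] Tang V n
  | 0 => ContinuousLinearMap.id ℝ V
  | n + 1 => (ContinuousLinearMap.inl ℝ (Tang V n) (Tang V n)).comp (Tang.incL V n)

/-- the sparse test vector -/
def Tang.test : ∀ n, V → (Fin n → V) → Tang V n
  | 0, v, _ => v
  | n + 1, v, h => (Tang.test n v (Fin.tail h), Tang.incL V n (h 0))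

theorem Tang.baseL_apply : ∀ n (p : Tang V n), Tang.baseL V n p = Tang.base n p
  | 0, _ => rfl
  | n + 1, p => Tang.baseL_apply n p.1

theorem Tang.base_test : ∀ n (v : V) (h : Fin n → V), Tang.base n (Tang.test n v h) = v
  | 0, _, _ => rfl
  | n + 1, v, h => Tang.base_test n v (Fin.tail h)

theorem Tang.withBase_test : ∀ n (u v : V) (h : Fin n → V),
    Tang.withBase n u (Tang.test n v h) = Tang.test n u h
  | 0, _, _, _ => rfl
  | n + 1, u, v, h =>
    Prod.ext (Tang.withBase_test n u v (Fin.tail h)) rfl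

theorem Tang.test_eq : ∀ n (v : V) (h : Fin n → V),
    Tang.test n v h = Tang.incL V n v + Tang.test n 0 h
  | 0, v, _ => (add_zero v).symm
  | n + 1, v, h =>
    Prod.ext (Tang.test_eq n v (Fin.tail h)) (zero_add (Tang.incL V n (h 0))).symm

theorem Tang.norm_def (n : ℕ) (p : Tang V (n + 1)) : ‖p‖ = max ‖p.1‖ ‖p.2‖ := rfl

theorem Tang.norm_incL : ∀ n (v : V), ‖Tang.incL V n v‖ = ‖v‖
  | 0, _ => rfl
  | n + 1, v => by
    rw [Tang.norm_def]
    change max ‖Tang.incL V n v‖ ‖(0 : Tang V n)‖ = _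
    rw [Tang.norm_incL n v, norm_zero]
    exact max_eq_left (norm_nonneg v)

theorem Tang.norm_lastL_le : ∀ n (p : Tang V n), ‖Tang.lastL V n p‖ ≤ ‖p‖
  | 0, _ => le_rfl
  | n + 1, p => (Tang.norm_lastL_le n p.2).trans (le_max_right _ _)

theorem Tang.norm_lastL_le_fiberNorm (n : ℕ) (p : Tang V (n + 1)) :
    ‖Tang.lastL V (n + 1) p‖ ≤ Tang.fiberNorm (n + 1) p :=
  (Tang.norm_lastL_le n p.2).trans (le_max_right _ _)

theorem Tang.fiberNorm_test_le : ∀ n (v : V) (h : Fin n → V), (∀ i, ‖h i‖ ≤ 1) →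
    Tang.fiberNorm n (Tang.test n v h) ≤ 1
  | 0, _, _, _ => zero_le_one
  | n + 1, v, h, hh => by
    refine max_le (Tang.fiberNorm_test_le n v (Fin.tail h) fun i => hh i.succ) ?_
    change ‖Tang.incL V n (h 0)‖ ≤ 1
    rw [Tang.norm_incL]
    exact hh 0

/-- The jet of `f` at `x` up to order `n`. -/
def jet (f : V → W) (n : ℕ) (x : V) :
    (k : Fin (n + 1)) → ContinuousMultilinearMap ℝ (fun _ : Fin (k : ℕ) => V) W :=
  fun k => iteratedFDeriv ℝ (k : ℕ) f x

/-- truncation of jets -/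
def truncL (V : Type u) (W : Type v) [NormedAddCommGroup V] [NormedSpace ℝ V]
    [NormedAddCommGroup W] [NormedSpace ℝ W] (n : ℕ) :
    ((k : Fin (n + 2)) → ContinuousMultilinearMap ℝ (fun _ : Fin (k : ℕ) => V) W) →L[ℝ]
    ((k : Fin (n + 1)) → ContinuousMultilinearMap ℝ (fun _ : Fin (k : ℕ) => V) W) :=
  ContinuousLinearMap.pi fun k : Fin (n + 1) =>
    (ContinuousLinearMap.proj (k.castSucc) :
      ((k : Fin (n + 2)) → ContinuousMultilinearMap ℝ (fun _ : Fin (k : ℕ) => V) W) →L[ℝ]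
        ContinuousMultilinearMap ℝ (fun _ : Fin (k : ℕ) => V) W)

/-- shift of jets, as a linear map to linear maps -/
def shiftL (V : Type u) (W : Type v) [NormedAddCommGroup V] [NormedSpace ℝ V]
    [NormedAddCommGroup W] [NormedSpace ℝ W] (n : ℕ) (k : Fin (n + 1)) :
    ((k : Fin (n + 2)) → ContinuousMultilinearMap ℝ (fun _ : Fin (k : ℕ) => V) W) →L[ℝ]
    (V →L[ℝ] ContinuousMultilinearMap ℝ (fun _ : Fin (k : ℕ) => V) W) :=
  ((continuousMultilinearCurryLeftEquiv ℝ (fun _ : Fin ((k : ℕ) + 1) => V)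
    W).toContinuousLinearEquiv :
      ContinuousMultilinearMap ℝ (fun _ : Fin ((k : ℕ) + 1) => V) W →L[ℝ]
      (V →L[ℝ] ContinuousMultilinearMap ℝ (fun _ : Fin (k : ℕ) => V) W)).comp
    (ContinuousLinearMap.proj (k.succ) :
      ((k : Fin (n + 2)) → ContinuousMultilinearMap ℝ (fun _ : Fin (k : ℕ) => V) W) →L[ℝ]
        ContinuousMultilinearMap ℝ (fun _ : Fin ((k : ℕ) + 1) => V) W)

theorem hasFDerivAt_jet (f : V → W) (n : ℕ) (x : V)
    (h : ∀ k < n + 1, DifferentiableAt ℝ (iteratedFDeriv ℝ k f) x) :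
    HasFDerivAt (jet f n)
      (ContinuousLinearMap.pi fun k => shiftL V W n k (jet f (n + 1) x)) x := by
  rw [hasFDerivAt_pi]
  intro k
  exact (h k k.2).hasFDerivAt

theorem TMap_eq (f : V → W) (VV : Set V) (hVV : IsOpen VV) (n : ℕ)
    (hdiff : ∀ k < n, ∀ x ∈ VV, DifferentiableAt ℝ (iteratedFDeriv ℝ k f) x) :
    ∃ G : ((k : Fin (n + 1)) → ContinuousMultilinearMap ℝ (fun _ : Fin (k : ℕ) => V) W) ×
        Tang V n → Tang W n, ContDiff ℝ ((⊤ : ℕ∞) : WithTop ℕ∞) G ∧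
      ∀ p, Tang.base n p ∈ VV → TMap f n p = G (jet f n (Tang.base n p), p) := by
  induction n with
  | zero =>
    refine ⟨fun q => q.1 0 (fun i => Fin.elim0 i), ?_, ?_⟩
    · let A : ((k : Fin (0 + 1)) → ContinuousMultilinearMap ℝ (fun _ : Fin (k : ℕ) => V) W) →L[ℝ]
          W := (ContinuousMultilinearMap.apply ℝ (fun _ : Fin 0 => V) W
            (fun i => Fin.elim0 i)).comp (ContinuousLinearMap.proj (0 : Fin 1))
      exact A.contDiff.comp contDiff_fst
    · intro p _
      rfl
  | succ n ih =>
    obtain ⟨G, hG, hGe⟩ := ih fun k hk => hdiff k (hk.trans n.lt_succ_self)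
    let pairL (q : ((k : Fin (n + 1 + 1)) →
        ContinuousMultilinearMap ℝ (fun _ : Fin (k : ℕ) => V) W) × Tang V (n + 1)) :=
      (truncL V W n q.1, Tang.fstL V n q.2)
    have hpair : ContDiff ℝ ((⊤ : ℕ∞) : WithTop ℕ∞) pairL :=
      ((truncL V W n).contDiff.comp contDiff_fst).prodMk
        ((Tang.fstL V n).contDiff.comp contDiff_snd)
    let dirL (q : ((k : Fin (n + 1 + 1)) →
        ContinuousMultilinearMap ℝ (fun _ : Fin (k : ℕ) => V) W) × Tang V (n + 1)) :
        ((k : Fin (n + 1)) → ContinuousMultilinearMap ℝ (fun _ : Fin (k : ℕ) => V) W) × Tang V n :=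
      (fun k => shiftL V W n k q.1 (Tang.baseL V n (Tang.sndL V n q.2)), Tang.sndL V n q.2)
    have hdir : ContDiff ℝ ((⊤ : ℕ∞) : WithTop ℕ∞) dirL := by
      refine ContDiff.prodMk (contDiff_pi.2 fun k => ?_)
        ((Tang.sndL V n).contDiff.comp contDiff_snd)
      exact ((shiftL V W n k).contDiff.comp contDiff_fst).clm_apply
        ((Tang.baseL V n).contDiff.comp ((Tang.sndL V n).contDiff.comp contDiff_snd))
    have hG' : ContDiff ℝ ((⊤ : ℕ∞) : WithTop ℕ∞) (fderiv ℝ G) :=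
      hG.fderiv_right (by simp)
    refine ⟨fun q => (G (pairL q), fderiv ℝ G (pairL q) (dirL q)), ?_, ?_⟩
    · exact (hG.comp hpair).prodMk ((hG'.comp hpair).clm_apply hdir)
    · rintro ⟨p, q⟩ hp
      change Tang.base n p ∈ VV at hp
      refine Prod.ext (hGe p hp) ?_
      change fderiv ℝ (TMap f n) p q = _
      have hev : TMap f n =ᶠ[nhds p] fun p => G (jet f n (Tang.baseL V n p), p) := by
        have : (Tang.baseL V n) ⁻¹' VV ∈ nhds p :=
          (hVV.preimage (Tang.baseL V n).continuous).mem_nhds (by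
            rw [Set.mem_preimage, Tang.baseL_apply]; exact hp)
        filter_upwards [this] with y hy
        rw [Set.mem_preimage, Tang.baseL_apply] at hy
        rw [hGe y hy, Tang.baseL_apply]
      rw [hev.fderiv_eq]
      have hj : HasFDerivAt (jet f n) _ (Tang.baseL V n p) :=
        hasFDerivAt_jet f n _ fun k hk => hdiff k hk _ (by rw [Tang.baseL_apply]; exact hp)
      have hd : DifferentiableAt ℝ G (jet f n (Tang.baseL V n p), p) :=
        hG.differentiable (by simp) _
      have h2 := (hj.comp p (Tang.baseL V n).hasFDerivAt).prodMk (hasFDerivAt_id p)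
      have h3 := HasFDerivAt.comp (f := fun p => (jet f n (Tang.baseL V n p), p)) p hd.hasFDerivAt h2
      have h4 := h3.fderiv
      change fderiv ℝ (fun p => G (jet f n (Tang.baseL V n p), p)) p = _ at h4
      rw [h4]
      simp only [Tang.baseL_apply]
      rfl

theorem TMap_differentiableAt (f : V → W) (VV : Set V) (hVV : IsOpen VV) (n : ℕ)
    (hdiff : ∀ k < n + 1, ∀ x ∈ VV, DifferentiableAt ℝ (iteratedFDeriv ℝ k f) x)
    (p : Tang V n) (hp : Tang.base n p ∈ VV) : DifferentiableAt ℝ (TMap f n) p := by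
  obtain ⟨G, hG, hGe⟩ := TMap_eq f VV hVV n fun k hk => hdiff k (hk.trans n.lt_succ_self)
  have hp' : Tang.baseL V n p ∈ VV := by rw [Tang.baseL_apply]; exact hp
  have hev : TMap f n =ᶠ[nhds p] fun p => G (jet f n (Tang.baseL V n p), p) := by
    filter_upwards [(hVV.preimage (Tang.baseL V n).continuous).mem_nhds hp'] with y hy
    rw [Set.mem_preimage, Tang.baseL_apply] at hy
    rw [hGe y hy, Tang.baseL_apply]
  refine DifferentiableAt.congr_of_eventuallyEq ?_ hev
  have hj := hasFDerivAt_jet f n _ fun k hk => hdiff k hk _ hp'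
  have hd : DifferentiableAt ℝ G (jet f n (Tang.baseL V n p), p) :=
    hG.differentiable (by simp) _
  have h2 := (hj.comp p (Tang.baseL V n).hasFDerivAt).prodMk (hasFDerivAt_id p)
  exact (HasFDerivAt.comp (f := fun p => (jet f n (Tang.baseL V n p), p)) p hd.hasFDerivAt h2).differentiableAt

theorem last_TMap_test (f : V → W) (VV : Set V) (hVV : IsOpen VV) (n : ℕ)
    (hdiff : ∀ k < n, ∀ x ∈ VV, DifferentiableAt ℝ (iteratedFDeriv ℝ k f) x) :
    ∀ x ∈ VV, ∀ h : Fin n → V,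
      Tang.lastL W n (TMap f n (Tang.test n x h)) = iteratedFDeriv ℝ n f x h := by
  induction n with
  | zero => intro x _ h; rfl
  | succ n ih =>
    intro x hx h
    have ih := ih fun k hk => hdiff k (hk.trans n.lt_succ_self)
    change Tang.lastL W n (fderiv ℝ (TMap f n) (Tang.test n x (Fin.tail h))
      (Tang.incL V n (h 0))) = _
    rw [iteratedFDeriv_succ_apply_left]
    have ht : HasFDerivAt (fun y => Tang.test n y (Fin.tail h)) (Tang.incL V n) x := by
      have : (fun y => Tang.test n y (Fin.tail h)) =
          fun y => Tang.incL V n y + Tang.test n 0 (Fin.tail h) :=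
        funext fun y => Tang.test_eq n y (Fin.tail h)
      rw [this]
      exact (Tang.incL V n).hasFDerivAt.add_const _
    have hT := (TMap_differentiableAt f VV hVV n hdiff (Tang.test n x (Fin.tail h))
      (by rw [Tang.base_test]; exact hx)).hasFDerivAt
    have h1 := (Tang.lastL W n).hasFDerivAt.comp x (hT.comp x ht)
    have h2 := (ContinuousMultilinearMap.apply ℝ (fun _ : Fin n => V) W
      (Fin.tail h)).hasFDerivAt.comp x (hdiff n n.lt_succ_self x hx).hasFDerivAt
    have h3 := h1.congr_of_eventuallyEq (f₁ := fun y => iteratedFDeriv ℝ n f y (Fin.tail h)) (by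
      filter_upwards [hVV.mem_nhds hx] with y hy
      exact (ih y hy (Fin.tail h)).symm)
    exact congrArg (fun L : V →L[ℝ] W => L (h 0)) (h3.unique h2)

theorem opNorm_le_of_unit {n : ℕ}
    (Φ : ContinuousMultilinearMap ℝ (fun _ : Fin n => V) W) (M : ℝ) (hM : 0 ≤ M)
    (h : ∀ m : Fin n → V, (∀ i, ‖m i‖ ≤ 1) → ‖Φ m‖ ≤ M) : ‖Φ‖ ≤ M := by
  refine ContinuousMultilinearMap.opNorm_le_bound hM fun m => ?_
  have h1 : m = fun i => ‖m i‖ • (‖m i‖⁻¹ • m i) := by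
    funext i
    by_cases hi : m i = 0
    · simp [hi]
    · rw [smul_smul, mul_inv_cancel₀ (norm_ne_zero_iff.2 hi), one_smul]
  have h2 : Φ m = (∏ i, ‖m i‖) • Φ (fun i => ‖m i‖⁻¹ • m i) := by
    rw [← ContinuousMultilinearMap.map_smul_univ, ← h1]
  have h3 : ‖Φ (fun i => ‖m i‖⁻¹ • m i)‖ ≤ M := by
    refine h _ fun i => ?_
    rw [norm_smul, norm_inv, norm_norm]
    exact inv_mul_le_one
  have h4 : 0 ≤ ∏ i, ‖m i‖ := Finset.prod_nonneg fun i _ => norm_nonneg _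
  rw [h2, norm_smul, Real.norm_of_nonneg h4, mul_comm]
  exact mul_le_mul_of_nonneg_right h3 h4

end Helpers

/-- For an `ℓ`-times Fréchet differentiable map `f` on an open set and
`u₀, v₀` in this set, `‖D^ℓ f(u₀) − D^ℓ f(v₀)‖` is bounded by the supremum, over fiber
vectors `(x₁, …, x_N)` with `max ‖xᵢ‖ ≤ 1`, of the fiber norm of
`T^ℓ f (u₀, x₁, …, x_N) − T^ℓ f (v₀, x₁, …, x_N)` (stated here as: every upper bound `M`
of these fiber norms bounds `‖D^ℓ f(u₀) − D^ℓ f(v₀)‖`). -/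
theorem stmt_6 {V : Type u} {W : Type v}
    [NormedAddCommGroup V] [NormedSpace ℝ V] [NormedAddCommGroup W] [NormedSpace ℝ W]
    (ℓ : ℕ) (hℓ : 1 ≤ ℓ) (VV : Set V) (hVV : IsOpen VV) (f : V → W)
    (hdiff : ∀ k < ℓ, ∀ x ∈ VV, DifferentiableAt ℝ (iteratedFDeriv ℝ k f) x)
    (u₀ v₀ : V) (hu₀ : u₀ ∈ VV) (hv₀ : v₀ ∈ VV) (M : ℝ)
    (hM : ∀ x : Tang V ℓ, Tang.fiberNorm ℓ x ≤ 1 →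
      Tang.fiberNorm ℓ
        (TMap f ℓ (Tang.withBase ℓ u₀ x) - TMap f ℓ (Tang.withBase ℓ v₀ x)) ≤ M) :
    ‖iteratedFDeriv ℝ ℓ f u₀ - iteratedFDeriv ℝ ℓ f v₀‖ ≤ M := by
  obtain ⟨n, rfl⟩ : ∃ n, ℓ = n + 1 := ⟨ℓ - 1, by omega⟩
  have key : ∀ m : Fin (n + 1) → V, (∀ i, ‖m i‖ ≤ 1) →
      ‖(iteratedFDeriv ℝ (n + 1) f u₀ - iteratedFDeriv ℝ (n + 1) f v₀) m‖ ≤ M := by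
    intro m hm
    have h := hM (Tang.test (n + 1) u₀ m) (Tang.fiberNorm_test_le _ _ _ hm)
    rw [Tang.withBase_test, Tang.withBase_test] at h
    have h' := (Tang.norm_lastL_le_fiberNorm n _).trans h
    rw [map_sub, last_TMap_test f VV hVV _ hdiff u₀ hu₀, last_TMap_test f VV hVV _ hdiff v₀ hv₀]
      at h'
    exact h'
  exact opNorm_le_of_unit _ M ((norm_nonneg _).trans (key 0 fun i => by simp)) key

end
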